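/- Let n ≥ 1 and let w : Fin n → Fin n → EReal be edge lengths with no negative cycles, and let d₁ = G(w) be the matrix after one run of the IKJ algorithm starting from d = w. Then for every pair of vertices s, t with dist_w(s,t) < +∞, there exists a finite sequence of vertices s = v₀, v₁, …, v_{l'} = t that is strictly increasing except possibly at the last step (v₀ < v₁ < ⋯ < v_{l'−1}) such that the sum of d₁[v_p, v_{p+1}] over p equals dist_w(s,t). -/

import Mathlib

open scoped BigOperators

noncomputable section

/-- The total `d`-length of a walk, given as the list of visited vertices.
A walk visiting at most one vertex has length `0`. -/
def walkLen {n : ℕ} (d : Fin n → Fin n → EReal) : List (Fin n) → EReal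
  | [] => 0
  | [_] => 0
  | a :: b :: rest => d a b + walkLen d (b :: rest)

/-- Shortest-path distance from `s` to `t`: the infimum of walk lengths over all
finite walks from `s` to `t` (the empty walk `[s]` from `s` to `s` has length `0`). -/
def distW {n : ℕ} (d : Fin n → Fin n → EReal) (s t : Fin n) : EReal :=
  sInf {c : EReal | ∃ u : List (Fin n),
    u.head? = some s ∧ u.getLast? = some t ∧ walkLen d u = c}

/-- No negative cycles: every closed walk has nonnegative total length. -/
def NoNegCycle {n : ℕ} (w : Fin n → Fin n → EReal) : Prop :=
  ∀ (u : List (Fin n)) (v : Fin n),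
    u.head? = some v → u.getLast? = some v → 0 ≤ walkLen w u

/-- The relaxation update `d[i,j] ← min (d[i,j]) (d[i,k] + d[k,j])`,
leaving all other entries unchanged. -/
def upd {n : ℕ} (d : Fin n → Fin n → EReal) (i j k : Fin n) :
    Fin n → Fin n → EReal :=
  fun x y => if x = i ∧ y = j then min (d i j) (d i k + d k j) else d x y

/-- All triples of `Fin n` in lexicographic order. -/
def triplesLex (n : ℕ) : List (Fin n × Fin n × Fin n) :=
  (List.finRange n).flatMap fun a =>
    (List.finRange n).flatMap fun b =>
      (List.finRange n).map fun c => (a, b, c)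

/-- One run of the IJK algorithm: the triples `(i, j, k)` are processed in
lexicographic order of `(i, j, k)`, updating `d[i,j] ← min (d[i,j]) (d[i,k] + d[k,j])`. -/
def runIJK {n : ℕ} (d : Fin n → Fin n → EReal) : Fin n → Fin n → EReal :=
  (triplesLex n).foldl (fun d t => upd d t.1 t.2.1 t.2.2) d

/-- One run of the IKJ algorithm: the triples `(i, k, j)` are processed in
lexicographic order of `(i, k, j)`, updating `d[i,j] ← min (d[i,j]) (d[i,k] + d[k,j])`. -/
def runIKJ {n : ℕ} (d : Fin n → Fin n → EReal) : Fin n → Fin n → EReal :=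
  (triplesLex n).foldl (fun d t => upd d t.1 t.2.2 t.2.1) d

/-- One run of the (correct) KIJ Floyd–Warshall algorithm: the triples `(k, i, j)` are
processed in lexicographic order of `(k, i, j)`,
updating `d[i,j] ← min (d[i,j]) (d[i,k] + d[k,j])`. -/
def runKIJ {n : ℕ} (d : Fin n → Fin n → EReal) : Fin n → Fin n → EReal :=
  (triplesLex n).foldl (fun d t => upd d t.2.1 t.2.2 t.1) d

/-- The partial run of the IJK algorithm consisting of all update triples `(i, j, k)`
with `i ≤ m`, in lexicographic order. -/
def runIJKUpto {n : ℕ} (m : Fin n) (d : Fin n → Fin n → EReal) :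
    Fin n → Fin n → EReal :=
  ((triplesLex n).filter (fun t => decide (t.1 ≤ m))).foldl
    (fun d t => upd d t.1 t.2.1 t.2.2) d

/-- The partial run of the IKJ algorithm consisting of all update triples `(i, k, j)`
with `i ≤ m`, in lexicographic order. -/
def runIKJUpto {n : ℕ} (m : Fin n) (d : Fin n → Fin n → EReal) :
    Fin n → Fin n → EReal :=
  ((triplesLex n).filter (fun t => decide (t.1 ≤ m))).foldl
    (fun d t => upd d t.1 t.2.2 t.2.1) d

/-- The `d`-length of the portion `u_a, u_{a+1}, …, u_c` of the vertex sequence `u`. -/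
def pathLen {n : ℕ} (d : Fin n → Fin n → EReal) (u : ℕ → Fin n) (a c : ℕ) : EReal :=
  ∑ p ∈ Finset.Ico a c, d (u p) (u (p + 1))

/-- `u_0, …, u_l` is a shortest path w.r.t. `w`: every sub-walk `u_a, …, u_c`
has `w`-length equal to the shortest-path distance from `u_a` to `u_c`. -/
def IsShortestPath {n : ℕ} (w : Fin n → Fin n → EReal) (u : ℕ → Fin n) (l : ℕ) : Prop :=
  ∀ a c, a ≤ c → c ≤ l → pathLen w u a c = distW w (u a) (u c)

/-- `HasWalk d s t c`: some walk from `s` to `t` has `d`-length `c`. -/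
inductive HasWalk {n : ℕ} (d : Fin n → Fin n → EReal) : Fin n → Fin n → EReal → Prop
  | nil (s : Fin n) : HasWalk d s s 0
  | cons (s : Fin n) {b t : Fin n} {c : EReal} (h : HasWalk d b t c) : HasWalk d s t (d s b + c)

/-- `HasIncPath d s t c`: some vertex sequence from `s` to `t` which is strictly increasing,
except possibly at the last step, has `d`-length `c`. -/
inductive HasIncPath {n : ℕ} (d : Fin n → Fin n → EReal) : Fin n → Fin n → EReal → Prop
  | nil (s : Fin n) : HasIncPath d s s 0
  | single (s t : Fin n) : HasIncPath d s t (d s t)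
  | cons {s m t : Fin n} {c : EReal} (hsm : s < m) (h : HasIncPath d m t c) :
      HasIncPath d s t (d s m + c)

section Walks

variable {n : ℕ} {d w : Fin n → Fin n → EReal} {s m t : Fin n} {c c' : EReal}

theorem HasWalk.edge (d : Fin n → Fin n → EReal) (s t : Fin n) : HasWalk d s t (d s t) := by
  simpa using HasWalk.cons (d := d) s (HasWalk.nil t)

theorem HasWalk.trans (h : HasWalk d s m c) (h' : HasWalk d m t c') :
    HasWalk d s t (c + c') := by
  induction h with
  | nil => simpa using h'
  | cons s _ ih => rw [add_assoc]; exact .cons s (ih h')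

theorem HasWalk.exists_list (h : HasWalk d s t c) :
    ∃ u : List (Fin n), u.head? = some s ∧ u.getLast? = some t ∧ walkLen d u = c := by
  induction h with
  | nil s => exact ⟨[s], rfl, rfl, rfl⟩
  | cons s _ ih =>
    obtain ⟨u, hh, hl, rfl⟩ := ih
    match u, hh with
    | b :: r, rfl => exact ⟨s :: b :: r, rfl, by simpa using hl, rfl⟩

theorem hasWalk_walkLen (u : List (Fin n)) (hs : u.head? = some s)
    (ht : u.getLast? = some t) : HasWalk d s t (walkLen d u) := by
  induction u generalizing s with
  | nil => simp at hs
  | cons a r ih =>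
    obtain rfl : a = s := by simpa using hs
    cases r with
    | nil =>
      obtain rfl : a = t := by simpa using ht
      exact .nil a
    | cons b r => exact .cons a (ih rfl (by simpa using ht))

theorem distW_eq_sInf_hasWalk (d : Fin n → Fin n → EReal) (s t : Fin n) :
    distW d s t = sInf {c | HasWalk d s t c} := by
  unfold distW
  congr 1
  ext c
  constructor
  · rintro ⟨u, hs, ht, rfl⟩
    exact hasWalk_walkLen u hs ht
  · exact HasWalk.exists_list

theorem NoNegCycle.nonneg (hw : NoNegCycle w) (h : HasWalk w s s c) : 0 ≤ c := by
  obtain ⟨u, hs, ht, rfl⟩ := h.exists_list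
  exact hw u s hs ht

theorem HasIncPath.hasWalk (hd : ∀ i j, HasWalk w i j (d i j)) (h : HasIncPath d s t c) :
    HasWalk w s t c := by
  induction h with
  | nil s => exact .nil s
  | single s t => exact hd s t
  | cons _ _ ih => exact (hd _ _).trans ih

theorem HasIncPath.exists_seq (h : HasIncPath d s t c) :
    ∃ (v : ℕ → Fin n) (l : ℕ), v 0 = s ∧ v l = t ∧
      (∀ p, p + 1 < l → v p < v (p + 1)) ∧ pathLen d v 0 l = c := by
  induction h with
  | nil s => exact ⟨fun _ => s, 0, rfl, rfl, by simp, by simp [pathLen]⟩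
  | single s t =>
    exact ⟨fun p => if p = 0 then s else t, 1, by simp, by simp, by simp, by simp [pathLen]⟩
  | @cons s m t c hsm _ ih =>
    obtain ⟨v, l, h0, hl, hv, hc⟩ := ih
    refine ⟨fun p => Nat.casesOn p s v, l + 1, rfl, hl, ?_, ?_⟩
    · rintro (_ | p) hp
      · simpa [h0] using hsm
      · exact hv p (by omega)
    · rw [← hc]
      simp only [pathLen, Nat.Ico_zero_eq_range]
      rw [Finset.sum_range_succ', add_comm, ← h0]
      rfl

theorem finite_setOf_hasIncPath (d : Fin n → Fin n → EReal) (s t : Fin n) :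
    {c | HasIncPath d s t c}.Finite := by
  induction s using WellFoundedGT.induction with
  | ind s ih =>
    refine (((Set.finite_singleton 0).union (Set.finite_singleton (d s t))).union
      ((Set.finite_Ioi s).biUnion fun m hm => (ih m hm).image (d s m + ·))).subset ?_
    rintro c (_ | _ | @⟨_, m, _, c, hsm, h⟩)
    · simp
    · simp
    · exact Or.inr (Set.mem_biUnion hsm ⟨c, h, rfl⟩)

end Walks

section Relaxation

variable {n : ℕ} {w : Fin n → Fin n → EReal}

theorem foldl_le_self {α β : Type*} [Preorder β] {f : β → α → β} (hf : ∀ d a, f d a ≤ d)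
    (l : List α) (d : β) : l.foldl f d ≤ d := by
  induction l generalizing d with
  | nil => exact le_rfl
  | cons a l ih => exact (ih _).trans (hf d a)

theorem foldl_apply_eq_self {α ι γ : Type*} {f : (ι → γ) → α → ι → γ} {r : ι} (l : List α)
    (hf : ∀ d, ∀ a ∈ l, f d a r = d r) (d : ι → γ) : l.foldl f d r = d r := by
  induction l generalizing d with
  | nil => rfl
  | cons a l ih =>
    rw [List.foldl_cons, ih (fun d b hb => hf d b (List.mem_cons_of_mem a hb)),
      hf d a List.mem_cons_self]

theorem upd_le (d : Fin n → Fin n → EReal) (i j k : Fin n) : upd d i j k ≤ d := by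
  intro x y
  unfold upd
  split_ifs with h
  · obtain ⟨rfl, rfl⟩ := h
    exact min_le_left _ _
  · exact le_rfl

theorem upd_row_of_ne (d : Fin n → Fin n → EReal) {i r : Fin n} (j k : Fin n) (h : r ≠ i) :
    upd d i j k r = d r := by
  ext y
  simp [upd, h]

theorem hasWalk_upd {d : Fin n → Fin n → EReal} (hd : ∀ x y, HasWalk w x y (d x y))
    (i j k x y : Fin n) : HasWalk w x y (upd d i j k x y) := by
  unfold upd
  split_ifs with h
  · obtain ⟨rfl, rfl⟩ := h
    rcases min_choice (d x y) (d x k + d k y) with h | h <;> rw [h]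
    · exact hd x y
    · exact (hd x k).trans (hd k y)
  · exact hd x y

theorem hasWalk_runIKJ (w : Fin n → Fin n → EReal) (x y : Fin n) :
    HasWalk w x y (runIKJ w x y) := by
  unfold runIKJ
  generalize triplesLex n = l
  suffices ∀ d : Fin n → Fin n → EReal, (∀ x y, HasWalk w x y (d x y)) →
      ∀ x y, HasWalk w x y (l.foldl (fun d t => upd d t.1 t.2.2 t.2.1) d x y) from
    this w (HasWalk.edge w) x y
  induction l with
  | nil => exact fun d hd => hd
  | cons a l ih => exact fun d hd => ih _ (hasWalk_upd hd _ _ _)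

theorem runIKJ_le (w : Fin n → Fin n → EReal) : runIKJ w ≤ w :=
  foldl_le_self (fun d (t : Fin n × Fin n × Fin n) => upd_le d t.1 t.2.2 t.2.1) _ w

/-- The updates `(i, k, j)` of the IKJ algorithm for fixed `i` and `k`. -/
def relaxVia (i : Fin n) (d : Fin n → Fin n → EReal) (k : Fin n) : Fin n → Fin n → EReal :=
  (List.finRange n).foldl (fun d j => upd d i j k) d

/-- The updates `(i, k, j)` of the IKJ algorithm for fixed `i`. -/
def relaxRow (d : Fin n → Fin n → EReal) (i : Fin n) : Fin n → Fin n → EReal :=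
  (List.finRange n).foldl (relaxVia i) d

theorem runIKJ_eq_foldl_relaxRow (w : Fin n → Fin n → EReal) :
    runIKJ w = (List.finRange n).foldl relaxRow w := by
  simp only [runIKJ, triplesLex, List.foldl_flatMap, List.foldl_map]
  rfl

theorem relaxVia_le (i : Fin n) (d : Fin n → Fin n → EReal) (k : Fin n) :
    relaxVia i d k ≤ d :=
  foldl_le_self (fun d j => upd_le d i j k) _ d

theorem relaxVia_row_of_ne {i r : Fin n} (h : r ≠ i) (d : Fin n → Fin n → EReal) (k : Fin n) :
    relaxVia i d k r = d r :=
  foldl_apply_eq_self _ (fun d j _ => upd_row_of_ne d j k h) d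

theorem relaxVia_apply_le (i : Fin n) (d : Fin n → Fin n → EReal) (k j : Fin n) :
    relaxVia i d k i j ≤ d i k + d k j := by
  obtain ⟨l, l', hl⟩ := List.append_of_mem (List.mem_finRange j)
  rw [relaxVia, hl, List.foldl_append, List.foldl_cons]
  have hd : l.foldl (fun d j => upd d i j k) d ≤ d :=
    foldl_le_self (fun d j => upd_le d i j k) _ d
  refine (foldl_le_self (fun d j => upd_le d i j k) l' _ i j).trans ?_
  simp only [upd, and_self, if_true]
  exact (min_le_right _ _).trans (add_le_add (hd i k) (hd k j))

theorem relaxRow_le (d : Fin n → Fin n → EReal) (i : Fin n) : relaxRow d i ≤ d :=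
  foldl_le_self (relaxVia_le i) _ d

theorem relaxRow_row_of_ne {i r : Fin n} (h : r ≠ i) (d : Fin n → Fin n → EReal) :
    relaxRow d i r = d r :=
  foldl_apply_eq_self _ (fun d k _ => relaxVia_row_of_ne h d k) d

theorem take_succ_finRange (k : Fin n) :
    (List.finRange n).take (k + 1) = (List.finRange n).take k ++ [k] := by
  rw [List.take_succ_eq_append_getElem (by simp)]
  simp

theorem runIKJ_row_eq_foldl_take (w : Fin n → Fin n → EReal) {r : Fin n} {i : ℕ} (h : r < i) :
    runIKJ w r = ((List.finRange n).take i).foldl relaxRow w r := by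
  rw [runIKJ_eq_foldl_relaxRow]
  conv_lhs => rw [← List.take_append_drop i (List.finRange n), List.foldl_append]
  refine foldl_apply_eq_self _ (fun d a ha => relaxRow_row_of_ne ?_ d) _
  rintro rfl
  obtain ⟨p, hp, hpr⟩ := List.mem_iff_getElem.1 ha
  simp [Fin.ext_iff] at hpr
  omega

/-- The successive values `R k` of row `i` during an IKJ run, before the updates through the
intermediate vertex `k`. -/
theorem exists_runIKJ_row_history (w : Fin n → Fin n → EReal) (i : Fin n) :
    ∃ R : ℕ → Fin n → EReal, R 0 ≤ w i ∧ Antitone R ∧ R n = runIKJ w i ∧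
      ∀ k < i, ∀ j, R (k + 1) j ≤ R k k + runIKJ w k j := by
  set D := ((List.finRange n).take i).foldl relaxRow w with hD
  have hsucc (k : Fin n) : ((List.finRange n).take (k + 1)).foldl (relaxVia i) D =
      relaxVia i (((List.finRange n).take k).foldl (relaxVia i) D) k := by
    rw [take_succ_finRange, List.foldl_append]
    rfl
  refine ⟨fun k => ((List.finRange n).take k).foldl (relaxVia i) D i, ?_, ?_, ?_, ?_⟩
  · exact foldl_le_self relaxRow_le _ w i
  · refine antitone_nat_of_succ_le fun k => ?_
    rcases lt_or_ge k n with hk | hk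
    · exact (congrFun (hsucc ⟨k, hk⟩) i).trans_le (relaxVia_le i _ _ i)
    · rw [List.take_of_length_le (by simp; omega), List.take_of_length_le (by simp; omega)]
  · rw [runIKJ_row_eq_foldl_take w (Nat.lt_succ_self i), Nat.succ_eq_add_one,
      take_succ_finRange, List.foldl_append, ← hD]
    beta_reduce
    rw [List.take_of_length_le (by simp)]
    rfl
  · intro k hk j
    beta_reduce
    rw [hsucc k]
    refine (relaxVia_apply_le i _ k j).trans_eq ?_
    rw [foldl_apply_eq_self (r := k) _ (fun d a _ => relaxVia_row_of_ne hk.ne d a),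
      runIKJ_row_eq_foldl_take w (i := i) hk]

/-- A walk from `i` to `m < i` followed by an increasing path can be replaced by an increasing
path from `i`, as soon as row `i` accounts for the walk before the updates through `m`. -/
theorem HasIncPath.exists_le_of_history (hw : NoNegCycle w) {i : Fin n}
    {R : ℕ → Fin n → EReal} (hR : Antitone R) (hRn : R n = runIKJ w i)
    (hstep : ∀ k < i, ∀ j, R (k + 1) j ≤ R k k + runIKJ w k j)
    {m t : Fin n} {x c : EReal} (h : HasIncPath (runIKJ w) m t c) (hmi : m < i)
    (hx : HasWalk w i m x) (hRx : R m m ≤ x) :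
    ∃ c', HasIncPath (runIKJ w) i t c' ∧ c' ≤ x + c := by
  have hfin (k : ℕ) (hk : k ≤ n) (j : Fin n) : runIKJ w i j ≤ R k j := hRn ▸ hR hk j
  induction h generalizing x with
  | nil m => exact ⟨_, .single i m, by simpa using (hfin m m.2.le m).trans hRx⟩
  | single m t =>
    exact ⟨_, .single i t, (hfin _ m.2 t).trans ((hstep m hmi t).trans (by gcongr))⟩
  | @cons m m' t c hmm h ih =>
    have hx' : HasWalk w i m' (x + runIKJ w m m') := hx.trans (hasWalk_runIKJ w m m')
    have hRx' : R (m + 1) m' ≤ x + runIKJ w m m' := (hstep m hmi m').trans (by gcongr)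
    simp only [← add_assoc]
    rcases lt_trichotomy m' i with hlt | rfl | hgt
    · exact ih hlt hx' ((hR (Nat.succ_le_of_lt hmm) m').trans hRx')
    · exact ⟨c, h, le_add_of_nonneg_left (hw.nonneg hx')⟩
    · exact ⟨_, .cons hgt h, by gcongr; exact (hfin _ m.2 m').trans hRx'⟩

theorem HasWalk.exists_hasIncPath_le (hw : NoNegCycle w) {s t : Fin n} {c : EReal}
    (h : HasWalk w s t c) : ∃ c', HasIncPath (runIKJ w) s t c' ∧ c' ≤ c := by
  induction h with
  | nil s => exact ⟨0, .nil s, le_rfl⟩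
  | @cons s b t c _ ih =>
    obtain ⟨c', hc', hle⟩ := ih
    rcases lt_trichotomy b s with hlt | rfl | hgt
    · obtain ⟨R, hR0, hR, hRn, hstep⟩ := exists_runIKJ_row_history w s
      obtain ⟨c'', h'', hle'⟩ := hc'.exists_le_of_history hw hR hRn hstep hlt
        (HasWalk.edge w s b) ((hR (Nat.zero_le b) b).trans (hR0 b))
      exact ⟨c'', h'', hle'.trans (by gcongr)⟩
    · exact ⟨c', hc', hle.trans (le_add_of_nonneg_left (hw.nonneg (HasWalk.edge w b b)))⟩
    · exact ⟨_, .cons hgt hc', add_le_add (runIKJ_le w s b) hle⟩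

end Relaxation

/-- After one run of the IKJ algorithm, every finite shortest path
distance is realized by a vertex sequence that is strictly increasing except possibly
at the last step, measured in the new matrix. -/
theorem ikj_one_run_increasing_path (n : ℕ) (hn : 1 ≤ n)
    (w : Fin n → Fin n → EReal) (hw : ∀ i j, w i j ≠ ⊥) (hncyc : NoNegCycle w)
    (s t : Fin n) (hst : distW w s t < ⊤) :
    ∃ (v : ℕ → Fin n) (l' : ℕ), v 0 = s ∧ v l' = t ∧
      (∀ p, p + 1 < l' → v p < v (p + 1)) ∧
      pathLen (runIKJ w) v 0 l' = distW w s t := by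
  obtain ⟨c, hc, hmin⟩ := Set.exists_min_image {c | HasIncPath (runIKJ w) s t c} id
    (finite_setOf_hasIncPath _ s t) ⟨_, .single s t⟩
  obtain ⟨v, l, h0, hl, hv, hlen⟩ := HasIncPath.exists_seq hc
  refine ⟨v, l, h0, hl, hv, ?_⟩
  rw [hlen, distW_eq_sInf_hasWalk]
  refine le_antisymm (le_sInf fun x hx => ?_)
    (sInf_le (HasIncPath.hasWalk (hasWalk_runIKJ w) hc))
  obtain ⟨c', hc', hle⟩ := HasWalk.exists_hasIncPath_le hncyc hx
  exact (hmin c' hc').trans hle
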